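/- The face and degeneracy maps of K(A,2) satisfy the mixed simplicial identities: ∂_i ∘ s_j = s_{j−1} ∘ ∂_i for i < j; ∂_j ∘ s_j = id = ∂_{j+1} ∘ s_j; and ∂_i ∘ s_j = s_j ∘ ∂_{i−1} for i > j+1, for all admissible indices on each K_q. -/

import Mathlib

/-!
Explicit simplicial group `K(A,2)` (Staic).  Degree `q` part is
`K2 A q = A^{q(q-1)/2}`, functions on pairs `0 ≤ u < v ≤ q-1`.
-/

/-- Index set for `K(A,2)` in degree `q`: pairs `(u,v)` with `0 ≤ u < v ≤ q-1`. -/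
abbrev P2 (q : ℕ) : Type := {p : ℕ × ℕ // p.1 < p.2 ∧ p.2 < q}

/-- `K(A,2)` in degree `q`. -/
abbrev K2 (A : Type*) [CommGroup A] (q : ℕ) : Type _ := P2 q → A

variable {A : Type*} [CommGroup A]

/-- The face map `∂ᵢ : K_{q+1} → K_q` of `K(A,2)`:
`b_{u,v} = a_{u,v}` if `u < v < i-1`, `b_{u,v} = a_{u,v} a_{u,i} a_{v,i}⁻¹` if `u < v = i-1`,
`b_{u,v} = a_{u,v+1}` if `u ≤ i-1 < v`, and `b_{u,v} = a_{u+1,v+1}` if `i-1 < u < v`. -/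
def del2 (q i : ℕ) (a : K2 A (q + 1)) : K2 A q := fun p =>
  have h1 : p.1.1 < p.1.2 := p.2.1
  have h2 : p.1.2 < q := p.2.2
  if h : p.1.2 + 1 < i then a ⟨(p.1.1, p.1.2), by omega⟩
  else if hv : p.1.2 + 1 = i then
    a ⟨(p.1.1, p.1.2), by omega⟩ * a ⟨(p.1.1, i), by omega⟩ * (a ⟨(p.1.2, i), by omega⟩)⁻¹
  else if p.1.1 < i then a ⟨(p.1.1, p.1.2 + 1), by omega⟩
  else a ⟨(p.1.1 + 1, p.1.2 + 1), by omega⟩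

/-- The degeneracy map `sᵢ : K_q → K_{q+1}` of `K(A,2)`:
`c_{u,v} = a_{u,v}` if `u < v < i`, `c_{u,v} = 1` if `u < v = i`,
`c_{u,v} = a_{u,v-1}` if `u < i < v` or `u = i < v-1`, `c_{u,v} = 1` if `u = i = v-1`,
and `c_{u,v} = a_{u-1,v-1}` if `i < u < v`. -/
def s2 (q i : ℕ) (hi : i ≤ q) (a : K2 A q) : K2 A (q + 1) := fun p =>
  have h1 : p.1.1 < p.1.2 := p.2.1
  have h2 : p.1.2 < q + 1 := p.2.2
  if h : p.1.2 < i then a ⟨(p.1.1, p.1.2), by omega⟩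
  else if h' : p.1.2 = i then 1
  else if hu : p.1.1 < i then a ⟨(p.1.1, p.1.2 - 1), by omega⟩
  else if hu' : p.1.1 = i then
    (if hv : p.1.2 = i + 1 then 1 else a ⟨(p.1.1, p.1.2 - 1), by omega⟩)
  else a ⟨(p.1.1 - 1, p.1.2 - 1), by omega⟩

/-- The cyclic operator `τ_q : K_q → K_q` of `K(A,2)`:
`e_{0,v} = a_{v-1,v} ⋯ a_{v-1,q-1} · a_{v,v+1}⁻¹ ⋯ a_{v,q-1}⁻¹` and
`e_{u,v} = a_{u-1,v-1}` for `0 < u < v`. -/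
def tau2 (q : ℕ) (a : K2 A q) : K2 A q := fun p =>
  have h1 : p.1.1 < p.1.2 := p.2.1
  have h2 : p.1.2 < q := p.2.2
  if h : p.1.1 = 0 then
    (∏ t ∈ (Finset.Ico p.1.2 q).attach,
        a ⟨(p.1.2 - 1, t.1), by have := Finset.mem_Ico.mp t.2; omega⟩) *
    (∏ t ∈ (Finset.Ico (p.1.2 + 1) q).attach,
        (a ⟨(p.1.2, t.1), by have := Finset.mem_Ico.mp t.2; omega⟩)⁻¹)
  else a ⟨(p.1.1 - 1, p.1.2 - 1), by omega⟩


/-- Every element of `K2 A q` is the restriction of a function on all pairs of naturals. -/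
theorem K2.exists_eq_restrict {A : Type*} [CommGroup A] {q : ℕ} (a : K2 A q) :
    ∃ f : ℕ → ℕ → A, a = fun p => f p.1.1 p.1.2 :=
  ⟨fun u v => if h : u < v ∧ v < q then a ⟨(u, v), h⟩ else 1, by
    funext p
    simp [p.2.1, p.2.2]⟩

/-- The face and degeneracy maps of `K(A,2)` satisfy the mixed simplicial
identities: `∂ᵢ ∘ sⱼ = s_{j-1} ∘ ∂ᵢ` for `i < j`; `∂ⱼ ∘ sⱼ = id = ∂_{j+1} ∘ sⱼ`; and
`∂ᵢ ∘ sⱼ = sⱼ ∘ ∂_{i-1}` for `i > j + 1`, for all admissible indices on each `K_q`. -/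
theorem K2_mixed_identities (A : Type*) [CommGroup A] :
    (∀ q i j : ℕ, i < j → ∀ hj : j ≤ q + 1,
      (del2 (A := A) (q + 1) i) ∘ (s2 (q + 1) j hj) =
        (s2 q (j - 1) (by omega)) ∘ (del2 q i)) ∧
    (∀ q j : ℕ, ∀ hj : j ≤ q, (del2 (A := A) q j) ∘ (s2 q j hj) = id) ∧
    (∀ q j : ℕ, ∀ hj : j ≤ q, (del2 (A := A) q (j + 1)) ∘ (s2 q j hj) = id) ∧
    (∀ q i j : ℕ, ∀ hij : j + 1 < i, ∀ hi : i ≤ q + 2,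
      (del2 (A := A) (q + 1) i) ∘ (s2 (q + 1) j (by omega)) =
        (s2 q j (by omega)) ∘ (del2 q (i - 1))) := by
  refine ⟨fun q i j hij hj => ?_, fun q j hj => ?_, fun q j hj => ?_, fun q i j hij hi => ?_⟩ <;>
  · funext a ⟨⟨u, v⟩, huv, hv⟩
    obtain ⟨f, rfl⟩ := K2.exists_eq_restrict a
    simp only [Function.comp_apply, id, del2, s2]
    grind (splits := 30) [mul_one, one_mul, inv_one, mul_inv_cancel, mul_inv_cancel_right]
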